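/- Let k₀ be a commutative ring with a linear form θ such that ⟨a,b⟩ := θ(ab) is a non-degenerate bilinear form, and let R₀ ⊆ k₀ be a maximal isotropic subalgebra. If a₀ ∈ R₀ ⊗ k₀ satisfies ⟨a₀ + ã₀, id ⊗ β⟩ = β for all β ∈ k₀ (where ã₀ denotes a₀ with its two tensor factors exchanged), then for every α ∈ k₀, (α ⊗ 1 − 1 ⊗ α)·ã₀ = −(α ⊗ 1 − 1 ⊗ α)·a₀ in k₀ ⊗ k₀. -/

import Mathlib

/- STATEMENT 1: Let `k₀` be a commutative (Frobenius) ℂ-algebra with linear form `θ`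
such that `⟨a,b⟩ = θ(ab)` is non-degenerate, and `R₀ ⊆ k₀` a maximal isotropic
subalgebra.  If `a₀ ∈ R₀ ⊗ k₀` satisfies `⟨a₀ + ã₀, id ⊗ β⟩ = β` for all `β ∈ k₀`
(where `ã₀` is `a₀` with factors exchanged), then for every `α ∈ k₀`,
`(α⊗1 − 1⊗α)·ã₀ = −(α⊗1 − 1⊗α)·a₀` in `k₀ ⊗ k₀`. -/

noncomputable section

open TensorProduct

/-- contraction of the second tensor factor against a test element `β` via the
Frobenius form: `x ⊗ y ↦ θ(yβ) x`. -/
def contractWith {k₀ : Type*} [CommRing k₀] [Algebra ℂ k₀]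
    (θ : k₀ →ₗ[ℂ] ℂ) (β : k₀) : (k₀ ⊗[ℂ] k₀) →ₗ[ℂ] k₀ :=
  (TensorProduct.rid ℂ k₀).toLinearMap ∘ₗ
    TensorProduct.map LinearMap.id (θ ∘ₗ LinearMap.mulLeft ℂ β)

/-- Contraction in the second factor is linear over multiplication in the first factor. -/
theorem contractWith_tmul_one_mul {k₀ : Type*} [CommRing k₀] [Algebra ℂ k₀]
    (θ : k₀ →ₗ[ℂ] ℂ) (α β : k₀) (t : k₀ ⊗[ℂ] k₀) :
    contractWith θ β ((α ⊗ₜ[ℂ] (1 : k₀)) * t) = α * contractWith θ β t := by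
  induction t with
  | zero => simp
  | add x y hx hy => simp only [mul_add, map_add, hx, hy]
  | tmul x y => simp [contractWith]

/-- Multiplication in the second factor can be moved to the element contracted against. -/
theorem contractWith_one_tmul_mul {k₀ : Type*} [CommRing k₀] [Algebra ℂ k₀]
    (θ : k₀ →ₗ[ℂ] ℂ) (α β : k₀) (t : k₀ ⊗[ℂ] k₀) :
    contractWith θ β (((1 : k₀) ⊗ₜ[ℂ] α) * t) = contractWith θ (α * β) t := by
  induction t with
  | zero => simp
  | add x y hx hy => simp only [mul_add, map_add, hx, hy]
  | tmul x y => simp [contractWith, mul_left_comm]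

/-- If the pairing `θ (a * b)` is non-degenerate, a tensor all of whose contractions vanish
is zero. -/
theorem eq_zero_of_contractWith_eq_zero {k₀ : Type*} [CommRing k₀] [Algebra ℂ k₀]
    (θ : k₀ →ₗ[ℂ] ℂ) (hnd : ∀ a : k₀, (∀ b : k₀, θ (a * b) = 0) → a = 0)
    (t : k₀ ⊗[ℂ] k₀) (ht : ∀ β, contractWith θ β t = 0) : t = 0 := by
  classical
  let b := Module.Basis.ofVectorSpace ℂ k₀
  have key : ∀ (β : k₀) (i) (t : k₀ ⊗[ℂ] k₀),
      θ (TensorProduct.equivFinsuppOfBasisLeft b t i * β)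
        = b.repr (contractWith θ β t) i := by
    intro β i t
    induction t with
    | zero => simp
    | add x y hx hy => simp only [map_add, Finsupp.add_apply, add_mul, hx, hy]
    | tmul x y => simp [contractWith, mul_comm]
  apply (TensorProduct.equivFinsuppOfBasisLeft b).injective
  ext i
  rw [map_zero, Finsupp.zero_apply]
  exact hnd _ fun β => by rw [key, ht, map_zero, Finsupp.zero_apply]

theorem stmt1 {k₀ : Type*} [CommRing k₀] [Algebra ℂ k₀]
    (θ : k₀ →ₗ[ℂ] ℂ)
    -- non-degeneracy of the Frobenius pairing ⟨a,b⟩ = θ(ab)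
    (hnd : ∀ a : k₀, (∀ b : k₀, θ (a * b) = 0) → a = 0)
    (R₀ : Subalgebra ℂ k₀)
    -- R₀ is isotropic
    (hiso : ∀ a ∈ R₀, ∀ b ∈ R₀, θ (a * b) = 0)
    -- and maximal isotropic
    (hmax : ∀ a : k₀, (∀ b ∈ R₀, θ (a * b) = 0) → a ∈ R₀)
    (a₀ : k₀ ⊗[ℂ] k₀)
    -- a₀ ∈ R₀ ⊗ k₀
    (ha₀ : a₀ ∈ LinearMap.range
      (TensorProduct.map (R₀.toSubmodule.subtype) (LinearMap.id (R := ℂ) (M := k₀))))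
    -- ⟨a₀ + ã₀, id ⊗ β⟩ = β for all β
    (hker : ∀ β : k₀,
      contractWith θ β (a₀ + (TensorProduct.comm ℂ k₀ k₀) a₀) = β) :
    ∀ α : k₀,
      (α ⊗ₜ[ℂ] (1 : k₀) - (1 : k₀) ⊗ₜ[ℂ] α) * ((TensorProduct.comm ℂ k₀ k₀) a₀)
        = - ((α ⊗ₜ[ℂ] (1 : k₀) - (1 : k₀) ⊗ₜ[ℂ] α) * a₀) := by
  intro α
  rw [eq_neg_iff_add_eq_zero, ← mul_add]
  refine eq_zero_of_contractWith_eq_zero θ hnd _ fun β => ?_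
  rw [add_comm, sub_mul, map_sub, contractWith_tmul_one_mul, contractWith_one_tmul_mul,
    hker, hker, sub_self]

end
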